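/- The multiplication map by g on D^{p,q} is injective if and only if p + q ≤ n − 1, bijective if and only if p + q = n − 1, and surjective if and only if p + q ≥ n − 1. -/

import Mathlib

open scoped BigOperators

namespace DoubleForm

/-- The model Euclidean vector space of dimension `n` (with the standard inner product). -/
abbrev V (n : ℕ) := Fin n → ℝ

/-- The standard orthonormal basis of `V n`. -/
def E (n : ℕ) (j : Fin n) : V n := fun k => if k = j then 1 else 0

/-- Raw double forms of bidegree `(p,q)`: real valued functions of `p` vectors and `q` vectors.
Genuine double forms are singled out by `IsDF`. -/
abbrev DF (n p q : ℕ) := (Fin p → V n) → (Fin q → V n) → ℝ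

/-- `ω` is a genuine double form: multilinear and alternating in the first `p`
and in the last `q` arguments. -/
def IsDF {n p q : ℕ} (ω : DF n p q) : Prop :=
  ∃ F : AlternatingMap ℝ (V n) (AlternatingMap ℝ (V n) ℝ (Fin q)) (Fin p),
    ∀ x y, ω x y = F x y

/-- Transport of double forms along equalities of the degrees. -/
def DFcast {n p q p' q' : ℕ} (h1 : p = p') (h2 : q = q') (ω : DF n p q) : DF n p' q' :=
  fun x y => ω (fun i => x (Fin.cast h1 i)) (fun j => y (Fin.cast h2 j))

/-- The product of double forms (Kulkarni's product). -/
noncomputable def mul {n p q r s : ℕ} (ω : DF n p q) (η : DF n r s) :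
    DF n (p + r) (q + s) := fun x y =>
  (((p.factorial * r.factorial * q.factorial * s.factorial : ℕ) : ℝ))⁻¹ *
    ∑ σ : Equiv.Perm (Fin (p + r)), ∑ ρ : Equiv.Perm (Fin (q + s)),
      ((Equiv.Perm.sign σ : ℤ) : ℝ) * ((Equiv.Perm.sign ρ : ℤ) : ℝ) *
        ω (fun i => x (σ (Fin.castAdd r i))) (fun j => y (ρ (Fin.castAdd s j))) *
        η (fun i => x (σ (Fin.natAdd p i))) (fun j => y (ρ (Fin.natAdd q j)))

/-- The metric `g` as a double form of bidegree `(1,1)`. -/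
noncomputable def gm (n : ℕ) : DF n 1 1 := fun x y => ∑ j : Fin n, x 0 j * y 0 j

/-- Powers `g^l` of the metric in the algebra of double forms. -/
noncomputable def gpow (n : ℕ) : (l : ℕ) → DF n l l
  | 0 => fun _ _ => 1
  | l + 1 => mul (gpow n l) (gm n)

/-- The contraction map `c : D^{p,q} → D^{p-1,q-1}` (zero if `p = 0` or `q = 0`). -/
noncomputable def contr {n : ℕ} : ∀ {p q : ℕ}, DF n p q → DF n (p - 1) (q - 1)
  | p + 1, q + 1, ω => fun x y =>
      ∑ j : Fin n, ω (Fin.cons (E n j) x) (Fin.cons (E n j) y)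
  | 0, _, _ => 0
  | _ + 1, 0, _ => 0

/-- Iterated contraction `c^k`. -/
noncomputable def ck {n : ℕ} : ∀ (k : ℕ) {p q : ℕ}, DF n p q → DF n (p - k) (q - k)
  | 0, _, _, ω => ω
  | k + 1, _, _, ω => contr (ck k ω)

/-- The natural inner product on `D^{p,q}`. -/
noncomputable def innerDF {n p q : ℕ} (ω θ : DF n p q) : ℝ :=
  (((p.factorial * q.factorial : ℕ) : ℝ))⁻¹ *
    ∑ f : Fin p → Fin n, ∑ g : Fin q → Fin n,
      ω (fun i => E n (f i)) (fun j => E n (g j)) *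
        θ (fun i => E n (f i)) (fun j => E n (g j))

/-- The natural inner product extended to all bidegrees: distinct bidegrees are orthogonal. -/
noncomputable def innerDF2 {n p q r s : ℕ} (ω : DF n p q) (θ : DF n r s) : ℝ :=
  if h : p = r ∧ q = s then innerDF (DFcast h.1 h.2 ω) θ else 0

/-- Determinant of the `n × n` matrix whose first `p` rows are the basis vectors `E (f i)`
and whose remaining rows are the vectors `x`. -/
noncomputable def rowsDet {n : ℕ} (p : ℕ) (f : Fin p → Fin n) (x : Fin (n - p) → V n) : ℝ :=
  Matrix.det (Matrix.of fun i k : Fin n =>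
    if h : (i : ℕ) < p then E n (f ⟨(i : ℕ), h⟩) k
    else x ⟨(i : ℕ) - p, by have := i.isLt; omega⟩ k)

/-- The Hodge star operator extended to double forms, `D^{p,q} → D^{n-p,n-q}`. -/
noncomputable def hstar {n p q : ℕ} (ω : DF n p q) : DF n (n - p) (n - q) := fun x y =>
  (((p.factorial * q.factorial : ℕ) : ℝ))⁻¹ *
    ∑ f : Fin p → Fin n, ∑ g : Fin q → Fin n,
      ω (fun i => E n (f i)) (fun j => E n (g j)) * rowsDet p f x * rowsDet q g y

/-- The first Bianchi sum `B : D^{p,q} → D^{p+1,q-1}` (zero if `q = 0`). -/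
noncomputable def bianchi {n : ℕ} : ∀ {p q : ℕ}, DF n p q → DF n (p + 1) (q - 1)
  | p, q + 1, ω => fun x y =>
      ∑ j : Fin (p + 1), (-1 : ℝ) ^ ((j : ℕ) + 1) *
        ω (fun i => x (j.succAbove i)) (Fin.cons (x j) y)
  | _, 0, _ => 0

/-- Symmetric double forms of bidegree `(p,p)`. -/
def IsSymm {n p : ℕ} (ω : DF n p p) : Prop := ∀ x y, ω x y = ω y x

/-- The total (bigraded) space of double forms. -/
abbrev DT (n : ℕ) := ∀ p q : ℕ, DF n p q

/-- Embedding of the component `D^{p,q}` into the total space. -/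
noncomputable def emb {n : ℕ} (p q : ℕ) (ω : DF n p q) : DT n := fun p' q' =>
  if h : p = p' ∧ q = q' then DFcast h.1 h.2 ω else 0

section Auxiliary

open AlternatingMap

section Wedge

variable {M N N' : Type*} [AddCommGroup M] [Module ℝ M] [AddCommGroup N] [Module ℝ N]
  [AddCommGroup N'] [Module ℝ N']

/-- Evaluation of alternating maps at a tuple. -/
def evalAt {ι : Type*} (x : ι → M) : (M [⋀^ι]→ₗ[ℝ] N) →ₗ[ℝ] N where
  toFun f := f x
  map_add' _ _ := rfl
  map_smul' _ _ := rfl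

theorem evalAt_apply {ι : Type*} (x : ι → M) (f : M [⋀^ι]→ₗ[ℝ] N) : evalAt x f = f x := rfl

theorem alternatingMap_sum_apply {ι κ : Type*} (s : Finset κ) (f : κ → M [⋀^ι]→ₗ[ℝ] N)
    (x : ι → M) : (∑ k ∈ s, f k) x = ∑ k ∈ s, f k x :=
  map_sum (evalAt x) f s

/-- Exterior multiplication by a linear functional. -/
noncomputable def wedge {p : ℕ} (φ : M →ₗ[ℝ] ℝ) :
    (M [⋀^Fin p]→ₗ[ℝ] N) →ₗ[ℝ] (M [⋀^Fin (p + 1)]→ₗ[ℝ] N) :=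
  alternatizeUncurryFinLM ∘ₗ LinearMap.smulRightₗ φ

theorem wedge_apply {p : ℕ} (φ : M →ₗ[ℝ] ℝ) (f : M [⋀^Fin p]→ₗ[ℝ] N) (x : Fin (p + 1) → M) :
    wedge φ f x = ∑ i : Fin (p + 1), (-1 : ℝ) ^ (i : ℕ) • φ (x i) • f (i.removeNth x) := by
  simp only [wedge, LinearMap.comp_apply, alternatizeUncurryFinLM_apply,
    alternatizeUncurryFin_apply, LinearMap.smulRightₗ_apply, LinearMap.smulRight_apply,
    AlternatingMap.smul_apply]
  refine Finset.sum_congr rfl fun i _ => ?_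
  rcases Nat.even_or_odd (i : ℕ) with h | h <;> simp [h.neg_one_pow]

/-- Interior multiplication by a vector. -/
def interior {p : ℕ} (v : M) : (M [⋀^Fin (p + 1)]→ₗ[ℝ] N) →ₗ[ℝ] (M [⋀^Fin p]→ₗ[ℝ] N) :=
  curryLeftLinearMap.flip v

theorem interior_apply {p : ℕ} (v : M) (f : M [⋀^Fin (p + 1)]→ₗ[ℝ] N) (x : Fin p → M) :
    interior v f x = f (Fin.cons v x) := rfl

theorem interior_compAlternatingMap {p : ℕ} (v : M) (h : N →ₗ[ℝ] N')
    (f : M [⋀^Fin (p + 1)]→ₗ[ℝ] N) :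
    interior v (h.compAlternatingMap f) = h.compAlternatingMap (interior v f) := rfl

theorem wedge_compAlternatingMap {p : ℕ} (φ : M →ₗ[ℝ] ℝ) (h : N →ₗ[ℝ] N')
    (f : M [⋀^Fin p]→ₗ[ℝ] N) :
    wedge φ (h.compAlternatingMap f) = h.compAlternatingMap (wedge φ f) := by
  ext x
  simp [wedge_apply]

/-- The composite `φ ∧ ι_v` on forms of any degree (zero in degree zero), written through the
anticommutation relation. -/
noncomputable def wedgeInterior {p : ℕ} (φ : M →ₗ[ℝ] ℝ) (v : M) :
    (M [⋀^Fin p]→ₗ[ℝ] N) →ₗ[ℝ] (M [⋀^Fin p]→ₗ[ℝ] N) :=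
  φ v • LinearMap.id - interior v ∘ₗ wedge φ

theorem interior_wedge {p : ℕ} (φ : M →ₗ[ℝ] ℝ) (v : M) (f : M [⋀^Fin p]→ₗ[ℝ] N) :
    interior v (wedge φ f) = φ v • f - wedgeInterior φ v f := by
  simp [wedgeInterior]

theorem wedgeInterior_zero (φ : M →ₗ[ℝ] ℝ) (v : M) :
    (wedgeInterior φ v : (M [⋀^Fin 0]→ₗ[ℝ] N) →ₗ[ℝ] _) = 0 := by
  ext f x
  have : (Fin.removeNth 0 (Fin.cons v x : Fin 1 → M)) = x := Subsingleton.elim _ _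
  simp [wedgeInterior, interior_apply, wedge_apply, this]

theorem wedgeInterior_succ {p : ℕ} (φ : M →ₗ[ℝ] ℝ) (v : M) :
    (wedgeInterior φ v : (M [⋀^Fin (p + 1)]→ₗ[ℝ] N) →ₗ[ℝ] _) = wedge φ ∘ₗ interior v := by
  ext f x
  have h (i : Fin (p + 1)) : Fin.removeNth i.succ (Fin.cons v x : Fin (p + 2) → M) =
      Fin.cons v (i.removeNth x) := by
    ext j
    refine Fin.cases ?_ (fun j => ?_) j <;> simp [Fin.removeNth]
  simp only [wedgeInterior, LinearMap.sub_apply, LinearMap.smul_apply, LinearMap.id_apply,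
    LinearMap.comp_apply, AlternatingMap.sub_apply, AlternatingMap.smul_apply, interior_apply,
    wedge_apply]
  rw [Fin.sum_univ_succ]
  simp only [Fin.cons_succ, h, Fin.val_succ, pow_succ]
  simp

end Wedge

variable {n : ℕ}

theorem sum_wedgeInterior {N : Type*} [AddCommGroup N] [Module ℝ N] {p : ℕ}
    (f : V n [⋀^Fin p]→ₗ[ℝ] N) :
    ∑ k : Fin n, wedgeInterior (LinearMap.proj k) (Pi.single k (1 : ℝ)) f = (p : ℝ) • f := by
  cases p with
  | zero => simp [wedgeInterior_zero]
  | succ p =>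
    simp only [wedgeInterior_succ, LinearMap.comp_apply]
    ext x
    simp only [alternatingMap_sum_apply, wedge_apply]
    rw [Finset.sum_comm]
    have h := congrArg (fun F => F x) (alternatizeUncurryFin_curryLeft f)
    simp only [alternatizeUncurryFin_apply, AlternatingMap.smul_apply] at h
    rw [AlternatingMap.smul_apply, Nat.cast_smul_eq_nsmul, ← h]
    refine Finset.sum_congr rfl fun i _ => ?_
    rw [← Finset.smul_sum]
    have : ∑ k : Fin n, (LinearMap.proj k : V n →ₗ[ℝ] ℝ) (x i) •
        interior (Pi.single k (1 : ℝ)) f (i.removeNth x) =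
        f.curryLeft (x i) (i.removeNth x) := by
      conv_rhs => rw [pi_eq_sum_univ' (x i)]
      simp only [map_sum, map_smul, alternatingMap_sum_apply, AlternatingMap.smul_apply]
      rfl
    rw [this]
    rcases Nat.even_or_odd (i : ℕ) with h | h <;> simp [h.neg_one_pow]

theorem interior_wedge_ite_sub {N : Type*} [AddCommGroup N] [Module ℝ N] {p : ℕ} (k l : Fin n)
    (f : V n [⋀^Fin p]→ₗ[ℝ] N) (d : Fin n → V n [⋀^Fin p]→ₗ[ℝ] N) :
    interior (Pi.single k (1 : ℝ)) (wedge (LinearMap.proj l) ((if k = l then f else 0) - d l)) =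
      (if k = l then f - wedgeInterior (LinearMap.proj k) (Pi.single k (1 : ℝ)) f - d k else 0) +
      wedgeInterior (LinearMap.proj l) (Pi.single k (1 : ℝ)) (d l) := by
  rw [interior_wedge]
  by_cases h : k = l
  · subst h
    simp
    abel
  · simp [h, Ne.symm h]

theorem sum_sub_wedgeInterior_sub {N : Type*} [AddCommGroup N] [Module ℝ N] {p : ℕ} {c : ℝ}
    (f : V n [⋀^Fin p]→ₗ[ℝ] N) (d : Fin n → V n [⋀^Fin p]→ₗ[ℝ] N) (hd : ∑ k, d k = c • f) :
    ∑ k : Fin n, (f - wedgeInterior (LinearMap.proj k) (Pi.single k (1 : ℝ)) f - d k) =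
      ((n : ℝ) - p - c) • f := by
  simp only [Finset.sum_sub_distrib, sum_wedgeInterior, hd, sub_smul, Finset.sum_const,
    Finset.card_univ, Fintype.card_fin, Nat.cast_smul_eq_nsmul]

theorem sum_interior_wedge {N N' : Type*} [AddCommGroup N] [Module ℝ N] [AddCommGroup N']
    [Module ℝ N'] {p : ℕ} {c : ℝ} (w : Fin n → N →ₗ[ℝ] N') (ι : Fin n → N' →ₗ[ℝ] N)
    (d : Fin n → Fin n → N →ₗ[ℝ] N)
    (h : ∀ k l, ι k ∘ₗ w l = (if k = l then LinearMap.id else 0) - d k l)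
    (hc : ∑ k, d k k = c • LinearMap.id) (F : V n [⋀^Fin p]→ₗ[ℝ] N) :
    ∑ l, ∑ k, interior (Pi.single k (1 : ℝ))
        ((ι k).compAlternatingMap (wedge (LinearMap.proj l) ((w l).compAlternatingMap F))) =
      ∑ k, ∑ l, wedgeInterior (LinearMap.proj l) (Pi.single k (1 : ℝ))
        ((d k l).compAlternatingMap F) + ((n : ℝ) - p - c) • F := by
  have key (k l : Fin n) : (ι k).compAlternatingMap ((w l).compAlternatingMap F) =
      (if k = l then F else 0) - (d k l).compAlternatingMap F := by
    ext x
    have := LinearMap.congr_fun (h k l) (F x)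
    rw [LinearMap.comp_apply] at this
    by_cases hkl : k = l <;> simp [hkl] at this ⊢ <;> exact this
  simp only [← wedge_compAlternatingMap, key]
  rw [Finset.sum_comm]
  have key' (k l : Fin n) := interior_wedge_ite_sub k l F fun l => (d k l).compAlternatingMap F
  simp only [key', Finset.sum_add_distrib, Finset.sum_ite_eq, Finset.mem_univ, if_true]
  rw [add_comm]
  congr 1
  refine sum_sub_wedgeInterior_sub F _ ?_
  ext x
  have := LinearMap.congr_fun hc (F x)
  simpa [alternatingMap_sum_apply, LinearMap.sum_apply] using this

/-- Bundled double forms of bidegree `(p, q)`. The additive structure of the inner space is the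
one coming from its group structure, so that it matches the lemmas on general modules. -/
abbrev Form (n p q : ℕ) :=
  @AlternatingMap ℝ _ (V n) _ _ (V n [⋀^Fin q]→ₗ[ℝ] ℝ) AddCommGroup.toAddCommMonoid _ (Fin p)

/-- Multiplication by the metric on bundled double forms. -/
noncomputable def metricMul (n p q : ℕ) : Form n p q →ₗ[ℝ] Form n (p + 1) (q + 1) :=
  ∑ k : Fin n, wedge (LinearMap.proj k) ∘ₗ (wedge (LinearMap.proj k)).compAlternatingMapₗ ℝ

/-- The contraction on bundled double forms. -/
noncomputable def contraction (n p q : ℕ) : Form n (p + 1) (q + 1) →ₗ[ℝ] Form n p q :=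
  ∑ k : Fin n, interior (Pi.single k (1 : ℝ)) ∘ₗ
    (interior (Pi.single k (1 : ℝ))).compAlternatingMapₗ ℝ

/-- The operator `g ∘ c` on forms of any bidegree (zero if one of the degrees is zero). -/
noncomputable def metricContraction (n p q : ℕ) (F : Form n p q) : Form n p q :=
  ∑ k : Fin n, ∑ l : Fin n, wedgeInterior (LinearMap.proj l) (Pi.single k (1 : ℝ))
    ((wedgeInterior (LinearMap.proj l) (Pi.single k (1 : ℝ))).compAlternatingMap F)

theorem metricContraction_succ {p q : ℕ} (F : Form n (p + 1) (q + 1)) :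
    metricContraction n (p + 1) (q + 1) F = metricMul n p q (contraction n p q F) := by
  simp only [metricContraction, metricMul, contraction, LinearMap.sum_apply,
    LinearMap.comp_apply, map_sum, LinearMap.compAlternatingMapₗ_apply, wedgeInterior_succ]
  refine Finset.sum_congr rfl fun l _ => ?_
  refine Finset.sum_congr rfl fun k _ => ?_
  exact congrArg (wedge _) rfl

theorem contraction_metricMul {p q : ℕ} (F : Form n p q) :
    contraction n p q (metricMul n p q F) =
      metricContraction n p q F + ((n : ℝ) - p - q) • F := by
  simp only [metricMul, contraction, LinearMap.sum_apply, LinearMap.comp_apply, map_sum,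
    LinearMap.compAlternatingMapₗ_apply, metricContraction]
  refine sum_interior_wedge (fun l => wedge (LinearMap.proj l))
    (fun k => interior (Pi.single k (1 : ℝ)))
    (fun k l => wedgeInterior (LinearMap.proj l) (Pi.single k (1 : ℝ))) (fun k l => ?_) ?_ F
  · ext1 f
    simp only [LinearMap.comp_apply, interior_wedge, LinearMap.sub_apply]
    by_cases h : k = l <;> simp [h, eq_comm]
  · ext1 f
    simp only [LinearMap.sum_apply, sum_wedgeInterior]
    rfl

/-- The tuple of standard basis vectors with the given indices. -/
def basisTuple {p : ℕ} (f : Fin p → Fin n) : Fin p → V n := fun i => Pi.single (f i) 1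

theorem sum_wedge_mul {p : ℕ} (l : Fin n) (F : V n [⋀^Fin p]→ₗ[ℝ] ℝ)
    (H : V n [⋀^Fin (p + 1)]→ₗ[ℝ] ℝ) :
    ∑ f : Fin (p + 1) → Fin n, wedge (LinearMap.proj l) F (basisTuple f) * H (basisTuple f) =
      (p + 1) * ∑ f : Fin p → Fin n, F (basisTuple f) *
        interior (Pi.single l (1 : ℝ)) H (basisTuple f) := by
  simp only [wedge_apply, Finset.sum_mul]
  rw [Finset.sum_comm]
  have (i : Fin (p + 1)) : ∑ f : Fin (p + 1) → Fin n,
      ((-1 : ℝ) ^ (i : ℕ) • (LinearMap.proj l : V n →ₗ[ℝ] ℝ) (basisTuple f i) •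
        F (i.removeNth (basisTuple f))) * H (basisTuple f) =
      ∑ f : Fin p → Fin n, F (basisTuple f) *
        interior (Pi.single l (1 : ℝ)) H (basisTuple f) := by
    rw [← (Fin.insertNthEquiv (fun _ => Fin n) i).sum_comp, Fintype.sum_prod_type]
    rw [Finset.sum_eq_single l]
    · refine Finset.sum_congr rfl fun f _ => ?_
      have h1 : basisTuple (i.insertNth l f : Fin (p + 1) → Fin n) =
          i.insertNth (Pi.single l (1 : ℝ)) (basisTuple f) := by
        ext1 j
        refine Fin.succAboveCases i ?_ (fun j => ?_) j <;> simp [basisTuple]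
      have h2 := neg_one_pow_smul_map_insertNth H i (Pi.single l (1 : ℝ)) (basisTuple f)
      change (-1 : ℝ) ^ (i : ℕ) • (LinearMap.proj l : V n →ₗ[ℝ] ℝ)
        (basisTuple (i.insertNth l f : Fin (p + 1) → Fin n) i) •
        F (i.removeNth (basisTuple (i.insertNth l f : Fin (p + 1) → Fin n))) *
        H (basisTuple (i.insertNth l f : Fin (p + 1) → Fin n)) = _
      simp only [h1, Fin.removeNth_insertNth, Fin.insertNth_apply_same]
      rw [interior_apply]
      change _ = _ * H (Matrix.vecCons _ _)
      rw [← h2]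
      simp
      ring
    · intro b _ hb
      refine Finset.sum_eq_zero fun f _ => ?_
      simp [basisTuple, Ne.symm hb]
    · simp
  rw [Finset.sum_congr rfl fun i _ => this i]
  simp

/-- The (unnormalized) inner product on bundled double forms. -/
noncomputable def pairing {p q : ℕ} (F H : Form n p q) : ℝ :=
  ∑ f : Fin p → Fin n, ∑ g : Fin q → Fin n,
    F (basisTuple f) (basisTuple g) * H (basisTuple f) (basisTuple g)

theorem pairing_metricMul {p q : ℕ} (F : Form n p q) (H : Form n (p + 1) (q + 1)) :
    pairing (metricMul n p q F) H = (p + 1) * (q + 1) * pairing F (contraction n p q H) := by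
  have h1 (l : Fin n) : ∑ f : Fin (p + 1) → Fin n, ∑ g : Fin (q + 1) → Fin n,
      wedge (LinearMap.proj l) ((wedge (LinearMap.proj l)).compAlternatingMap F)
        (basisTuple f) (basisTuple g) * H (basisTuple f) (basisTuple g) =
      (p + 1) * (q + 1) * ∑ f : Fin p → Fin n, ∑ g : Fin q → Fin n,
        F (basisTuple f) (basisTuple g) *
          H (Fin.cons (Pi.single l 1) (basisTuple f)) (Fin.cons (Pi.single l 1) (basisTuple g)) := by
    rw [Finset.sum_comm]
    have h2 (g : Fin (q + 1) → Fin n) := sum_wedge_mul l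
      ((evalAt (basisTuple g)).compAlternatingMap ((wedge (LinearMap.proj l)).compAlternatingMap F))
      ((evalAt (basisTuple g)).compAlternatingMap H)
    simp only [wedge_compAlternatingMap, interior_compAlternatingMap,
      LinearMap.compAlternatingMap_apply, evalAt_apply] at h2
    simp only [wedge_compAlternatingMap, LinearMap.compAlternatingMap_apply]
    refine (Finset.sum_congr rfl fun g _ => h2 g).trans ?_
    rw [← Finset.mul_sum, Finset.sum_comm, mul_assoc, Finset.mul_sum _ _ ((q : ℝ) + 1)]
    congr 1
    refine Finset.sum_congr rfl fun f _ => ?_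
    exact sum_wedge_mul l (F (basisTuple f)) (interior (Pi.single l (1 : ℝ)) H (basisTuple f))
  simp only [pairing, metricMul, contraction, LinearMap.sum_apply, LinearMap.comp_apply,
    LinearMap.compAlternatingMapₗ_apply, alternatingMap_sum_apply, Finset.sum_mul,
    Finset.mul_sum]
  simp only [Finset.sum_comm (t := (Finset.univ : Finset (Fin n)))]
  refine Finset.sum_congr rfl fun l _ => (h1 l).trans ?_
  simp only [Finset.mul_sum]
  rfl

theorem eq_zero_of_pairing_self {p q : ℕ} {F : Form n p q} (h : pairing F F = 0) : F = 0 := by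
  have h0 (f : Fin p → Fin n) (g : Fin q → Fin n) : F (basisTuple f) (basisTuple g) = 0 := by
    have h1 := (Finset.sum_eq_zero_iff_of_nonneg fun f _ => Finset.sum_nonneg fun g _ =>
      mul_self_nonneg (F (basisTuple f) (basisTuple g))).1 h f (Finset.mem_univ f)
    have h2 := (Finset.sum_eq_zero_iff_of_nonneg fun g _ =>
      mul_self_nonneg (F (basisTuple f) (basisTuple g))).1 h1 g (Finset.mem_univ g)
    exact mul_self_eq_zero.1 h2
  refine (Pi.basisFun ℝ (Fin n)).ext_alternating fun f _ => ?_
  refine (Pi.basisFun ℝ (Fin n)).ext_alternating fun g _ => ?_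
  simp only [Pi.basisFun_apply]
  exact h0 f g

theorem pairing_self_nonneg {p q : ℕ} (F : Form n p q) : 0 ≤ pairing F F :=
  Finset.sum_nonneg fun _ _ => Finset.sum_nonneg fun _ _ => mul_self_nonneg _

theorem pairing_add_smul {p q : ℕ} (F G H : Form n p q) (c : ℝ) :
    pairing (F + c • G) H = pairing F H + c * pairing G H := by
  simp only [pairing, AlternatingMap.add_apply, AlternatingMap.smul_apply, Finset.mul_sum,
    ← Finset.sum_add_distrib, smul_eq_mul]
  refine Finset.sum_congr rfl fun f _ => Finset.sum_congr rfl fun g _ => ?_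
  ring

theorem pairing_zero_left {p q : ℕ} (H : Form n p q) : pairing 0 H = 0 := by
  simp [pairing]

theorem pairing_metricContraction_nonneg {p q : ℕ} (F : Form n p q) :
    0 ≤ pairing (metricContraction n p q F) F := by
  have hz : metricContraction n p q F = 0 → 0 ≤ pairing (metricContraction n p q F) F := by
    intro h
    rw [h, pairing_zero_left]
  rcases p with _ | p
  · exact hz (by simp [metricContraction, wedgeInterior_zero])
  rcases q with _ | q
  · refine hz ?_
    simp only [metricContraction, wedgeInterior_zero]
    refine Finset.sum_eq_zero fun k _ => Finset.sum_eq_zero fun l _ => ?_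
    exact _root_.map_zero _
  rw [metricContraction_succ, pairing_metricMul]
  exact mul_nonneg (by positivity) (pairing_self_nonneg _)

theorem metricMul_injective {p q : ℕ} (h : p + q + 1 ≤ n) :
    Function.Injective (metricMul n p q) := by
  rw [injective_iff_map_eq_zero]
  intro F hF
  have h1 := contraction_metricMul F
  rw [hF, _root_.map_zero] at h1
  have h2 := pairing_add_smul (metricContraction n p q F) F F ((n : ℝ) - p - q)
  rw [← h1, pairing_zero_left] at h2
  have h3 : (1 : ℝ) ≤ (n : ℝ) - p - q := by
    have : ((p + q + 1 : ℕ) : ℝ) ≤ n := by exact_mod_cast h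
    push_cast at this
    linarith
  refine eq_zero_of_pairing_self (le_antisymm ?_ (pairing_self_nonneg F))
  nlinarith [pairing_metricContraction_nonneg F, pairing_self_nonneg F]

theorem contraction_injective {p q : ℕ} (h : n ≤ p + q + 1) :
    Function.Injective (contraction n p q) := by
  rw [injective_iff_map_eq_zero]
  intro F hF
  have h1 := contraction_metricMul F
  rw [metricContraction_succ, hF, _root_.map_zero] at h1
  have h2 := pairing_metricMul F (metricMul n (p + 1) (q + 1) F)
  have h4 := pairing_add_smul 0 F F ((n : ℝ) - (p + 1 : ℕ) - (q + 1 : ℕ))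
  have h5 : pairing F (contraction n _ _ (metricMul n (p + 1) (q + 1) F)) =
      pairing (contraction n _ _ (metricMul n (p + 1) (q + 1) F)) F := by
    simp only [pairing, mul_comm]
  rw [h5, h1, h4, pairing_zero_left] at h2
  have h3 : (n : ℝ) - (p + 1 : ℕ) - (q + 1 : ℕ) ≤ -1 := by
    have : (n : ℝ) ≤ (p + q + 1 : ℕ) := by exact_mod_cast h
    push_cast at this ⊢
    linarith
  refine eq_zero_of_pairing_self (le_antisymm ?_ (pairing_self_nonneg F))
  have h6 := pairing_self_nonneg (metricMul n (p + 1) (q + 1) F)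
  rw [h2] at h6
  have h7 := nonneg_of_mul_nonneg_right h6 (by positivity)
  nlinarith [pairing_self_nonneg F]

instance finite_alternatingMap {N : Type*} [AddCommGroup N] [Module ℝ N] [Module.Finite ℝ N]
    (n p : ℕ) : Module.Finite ℝ (V n [⋀^Fin p]→ₗ[ℝ] N) :=
  Module.Finite.equiv exteriorPower.alternatingMapLinearEquiv.symm

theorem surjective_of_injective {N : Type*} [AddCommGroup N] [Module ℝ N] [Module.Finite ℝ N]
    {p : ℕ} {T : (V n [⋀^Fin p]→ₗ[ℝ] N) →ₗ[ℝ] (V n [⋀^Fin p]→ₗ[ℝ] N)}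
    (h : Function.Injective T) : Function.Surjective T :=
  LinearMap.injective_iff_surjective.1 h

theorem finrank_alternatingMap {N : Type*} [AddCommGroup N] [Module ℝ N] (n p : ℕ) :
    Module.finrank ℝ (V n [⋀^Fin p]→ₗ[ℝ] N) = n.choose p * Module.finrank ℝ N := by
  rw [(exteriorPower.alternatingMapLinearEquiv (R := ℝ) (M := V n) (N := N)
    (n := p)).finrank_eq, Module.finrank_linearMap, exteriorPower.finrank_eq, Module.finrank_fin_fun]

theorem finrank_form (n p q : ℕ) :
    Module.finrank ℝ (Form n p q) = n.choose p * n.choose q := by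
  have h := finrank_alternatingMap (N := ℝ) n q
  rw [Module.finrank_self, mul_one] at h
  exact (finrank_alternatingMap n p).trans (congrArg _ h)

theorem metricMul_surjective {p q : ℕ} (h : n ≤ p + q + 1) :
    Function.Surjective (metricMul n p q) := by
  have hinj : Function.Injective (metricMul n p q ∘ₗ contraction n p q) := by
    rw [injective_iff_map_eq_zero]
    intro F hF
    have h1 := pairing_metricMul (contraction n p q F) F
    rw [LinearMap.comp_apply] at hF
    rw [hF, pairing_zero_left] at h1
    have h2 := (mul_eq_zero.1 h1.symm).resolve_left (by positivity)
    exact (map_eq_zero_iff _ (contraction_injective h)).1 (eq_zero_of_pairing_self h2)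
  intro G
  obtain ⟨F, hF⟩ := surjective_of_injective hinj G
  exact ⟨contraction n p q F, hF⟩

theorem choose_mul_choose_succ (n p q : ℕ) :
    n.choose (p + 1) * n.choose (q + 1) * ((p + 1) * (q + 1)) =
      n.choose p * n.choose q * ((n - p) * (n - q)) := by
  have hp := Nat.choose_succ_right_eq n p
  have hq := Nat.choose_succ_right_eq n q
  calc _ = (n.choose (p + 1) * (p + 1)) * (n.choose (q + 1) * (q + 1)) := by ring
    _ = _ := by rw [hp, hq]; ring

theorem metricMul_injective_iff {p q : ℕ} (hp : p ≤ n) (hq : q ≤ n) :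
    Function.Injective (metricMul n p q) ↔ p + q + 1 ≤ n := by
  refine ⟨fun h => ?_, metricMul_injective⟩
  have : Module.Finite ℝ (Form n (p + 1) (q + 1)) := finite_alternatingMap n (p + 1)
  have h1 := LinearMap.finrank_le_finrank_of_injective h
  rw [finrank_form, finrank_form] at h1
  have h2 := Nat.mul_le_mul_right ((p + 1) * (q + 1)) h1
  rw [choose_mul_choose_succ] at h2
  have h3 := Nat.le_of_mul_le_mul_left h2
    (Nat.mul_pos (Nat.choose_pos hp) (Nat.choose_pos hq))
  by_contra hlt
  have h4 : (n - p) * (n - q) ≤ q * p := Nat.mul_le_mul (by omega) (by omega)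
  nlinarith

theorem metricMul_surjective_iff {p q : ℕ} (hp : p ≤ n) (hq : q ≤ n) :
    Function.Surjective (metricMul n p q) ↔ n ≤ p + q + 1 := by
  refine ⟨fun h => ?_, metricMul_surjective⟩
  have : Module.Finite ℝ (Form n p q) := finite_alternatingMap n p
  have h1 := LinearMap.finrank_le_finrank_of_surjective h
  rw [finrank_form, finrank_form] at h1
  have h2 := Nat.mul_le_mul_right ((p + 1) * (q + 1)) h1
  rw [choose_mul_choose_succ] at h2
  have h3 := Nat.le_of_mul_le_mul_left h2
    (Nat.mul_pos (Nat.choose_pos hp) (Nat.choose_pos hq))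
  by_contra hlt
  have h4 : (q + 2) * (p + 2) ≤ (n - p) * (n - q) := Nat.mul_le_mul (by omega) (by omega)
  nlinarith

theorem cycleRange_symm_mul_bijective (p : ℕ) :
    Function.Bijective fun a : Fin (p + 1) × Equiv.Perm (Fin p) =>
      (a.1.cycleRange.symm * Equiv.Perm.decomposeFin.symm (0, a.2) :
        Equiv.Perm (Fin (p + 1))) := by
  rw [Fintype.bijective_iff_injective_and_card]
  refine ⟨fun a b hab => ?_, by simp [Fintype.card_perm, Nat.factorial_succ]⟩
  have h1 : a.1 = b.1 := by simpa using DFunLike.congr_fun hab 0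
  obtain ⟨i, e⟩ := a
  obtain ⟨j, e'⟩ := b
  obtain rfl : i = j := h1
  simpa using hab

theorem sum_perm_sign {M : Type*} [AddCommGroup M] [Module ℝ M] {p : ℕ} (φ : M →ₗ[ℝ] ℝ)
    (f : M [⋀^Fin p]→ₗ[ℝ] ℝ) (x : Fin (p + 1) → M) :
    ∑ σ : Equiv.Perm (Fin (p + 1)), ((Equiv.Perm.sign σ : ℤ) : ℝ) * φ (x (σ 0)) *
      f (fun i => x (σ i.succ)) = p.factorial * wedge φ f x := by
  rw [← (Equiv.ofBijective _ (cycleRange_symm_mul_bijective p)).sum_comp,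
    Fintype.sum_prod_type, wedge_apply, Finset.mul_sum]
  refine Finset.sum_congr rfl fun i _ => ?_
  have h (e : Equiv.Perm (Fin p)) :
      f (fun j => x ((i.cycleRange.symm * Equiv.Perm.decomposeFin.symm (0, e)) j.succ)) =
        ((Equiv.Perm.sign e : ℤ) : ℝ) * f (i.removeNth x) := by
    have := f.map_perm (i.removeNth x) e
    rw [Units.smul_def, zsmul_eq_mul] at this
    rw [← this]
    congr 1
    ext j
    simp [Fin.removeNth]
  have hs (e : Equiv.Perm (Fin p)) :
      ((Equiv.Perm.sign e : ℤ) : ℝ) * ((Equiv.Perm.sign e : ℤ) : ℝ) = 1 := by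
    rcases Int.units_eq_one_or (Equiv.Perm.sign e) with h | h <;> simp [h]
  simp only [Equiv.ofBijective_apply, h]
  rw [Finset.sum_congr rfl (g := fun _ => (-1 : ℝ) ^ (i : ℕ) • φ (x i) • f (i.removeNth x))]
  · simp [Fintype.card_perm]
  · intro e _
    simp only [Equiv.Perm.sign_mul, Equiv.Perm.sign_symm, Fin.sign_cycleRange,
      Equiv.Perm.decomposeFin.symm_sign, if_true, one_mul, Equiv.Perm.mul_apply,
      Equiv.Perm.decomposeFin_symm_apply_zero, Fin.cycleRange_symm_zero, smul_eq_mul]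
    push_cast
    linear_combination (-1 : ℝ) ^ (i : ℕ) * φ (x i) * f (i.removeNth x) * hs e

theorem mul_gm_apply {p q : ℕ} {ω : DF n p q} {F : Form n p q} (h : ∀ x y, ω x y = F x y)
    (x : Fin (p + 1) → V n) (y : Fin (q + 1) → V n) :
    mul (gm n) ω (fun i => x (Fin.cast (add_comm 1 p) i))
      (fun j => y (Fin.cast (add_comm 1 q) j)) = metricMul n p q F x y := by
  have hx : mul (gm n) ω (fun i => x (Fin.cast (add_comm 1 p) i))
      (fun j => y (Fin.cast (add_comm 1 q) j)) =
      ((p.factorial : ℝ) * q.factorial)⁻¹ * ∑ σ : Equiv.Perm (Fin (p + 1)),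
        ∑ ρ : Equiv.Perm (Fin (q + 1)),
          ((Equiv.Perm.sign σ : ℤ) : ℝ) * ((Equiv.Perm.sign ρ : ℤ) : ℝ) *
            (∑ k, x (σ 0) k * y (ρ 0) k) *
            F (fun i => x (σ i.succ)) (fun j => y (ρ j.succ)) := by
    have hs (m : ℕ) (i : Fin m) :
        (finCongr (add_comm 1 m)).symm i.succ = Fin.natAdd 1 i := by
      ext
      simp [add_comm]
    have hz (m : ℕ) : (finCongr (add_comm 1 m)).symm 0 = Fin.castAdd m 0 := by
      ext
      simp
    unfold mul
    congr 1
    · simp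
    · refine Fintype.sum_equiv (finCongr (add_comm 1 p)).permCongr _ _ fun σ => ?_
      refine Fintype.sum_equiv (finCongr (add_comm 1 q)).permCongr _ _ fun ρ => ?_
      simp only [Equiv.Perm.sign_permCongr, Equiv.permCongr_apply, hs, hz, h, gm]
      rfl
  rw [hx]
  have hρ (k : Fin n) (v : Fin p → V n) :=
    sum_perm_sign (LinearMap.proj k : V n →ₗ[ℝ] ℝ) (F v) y
  have hσ (k : Fin n) := sum_perm_sign (LinearMap.proj k : V n →ₗ[ℝ] ℝ)
    ((evalAt y).compAlternatingMap ((wedge (LinearMap.proj k)).compAlternatingMap F)) x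
  have hk : ∑ σ : Equiv.Perm (Fin (p + 1)), ∑ ρ : Equiv.Perm (Fin (q + 1)),
      ((Equiv.Perm.sign σ : ℤ) : ℝ) * ((Equiv.Perm.sign ρ : ℤ) : ℝ) *
        (∑ k, x (σ 0) k * y (ρ 0) k) * F (fun i => x (σ i.succ)) (fun j => y (ρ j.succ)) =
      ∑ k : Fin n, ∑ σ : Equiv.Perm (Fin (p + 1)), ((Equiv.Perm.sign σ : ℤ) : ℝ) *
        x (σ 0) k * ∑ ρ : Equiv.Perm (Fin (q + 1)), ((Equiv.Perm.sign ρ : ℤ) : ℝ) *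
          y (ρ 0) k * F (fun i => x (σ i.succ)) (fun j => y (ρ j.succ)) := by
    conv_rhs => rw [Finset.sum_comm]
    refine Finset.sum_congr rfl fun σ _ => ?_
    simp only [Finset.mul_sum, Finset.sum_mul]
    conv_rhs => rw [Finset.sum_comm]
    refine Finset.sum_congr rfl fun ρ _ => ?_
    refine Finset.sum_congr rfl fun k _ => ?_
    ring
  rw [hk, metricMul, LinearMap.sum_apply, alternatingMap_sum_apply, alternatingMap_sum_apply,
    Finset.mul_sum]
  refine Finset.sum_congr rfl fun k _ => ?_
  rw [inv_mul_eq_iff_eq_mul₀ (by positivity)]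
  have hk' := hσ k
  rw [wedge_compAlternatingMap] at hk'
  calc _ = (q.factorial : ℝ) * ∑ σ : Equiv.Perm (Fin (p + 1)), ((Equiv.Perm.sign σ : ℤ) : ℝ) *
        x (σ 0) k * wedge (LinearMap.proj k) (F fun i => x (σ i.succ)) y := by
        rw [Finset.mul_sum]
        refine Finset.sum_congr rfl fun σ _ => ?_
        refine (congrArg _ (hρ k _)).trans ?_
        ring
    _ = _ := (congrArg _ hk').trans (by rw [← mul_assoc, mul_comm (q.factorial : ℝ)]; rfl)

theorem emb_eq_emb_iff {p q p' q' : ℕ} (hp : p = p') (hq : q = q') (ω : DF n p q)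
    (θ : DF n p' q') : emb p q ω = emb p' q' θ ↔ DFcast hp hq ω = θ := by
  subst hp hq
  refine ⟨fun h => ?_, fun h => congrArg _ h⟩
  have h' := congrFun (congrFun h p) q
  simp only [emb, and_self, dite_true] at h'
  exact h'

theorem dfcast_mul_gm {p q : ℕ} {ω : DF n p q} {F : Form n p q} (h : ∀ x y, ω x y = F x y) :
    DFcast (add_comm 1 p) (add_comm 1 q) (mul (gm n) ω) = fun x y => metricMul n p q F x y :=
  funext fun x => funext fun y => mul_gm_apply h x y

theorem dfcast_eq_zero_iff {p q p' q' : ℕ} (hp : p = p') (hq : q = q') (ω : DF n p q) :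
    DFcast hp hq ω = 0 ↔ ω = 0 := by
  subst hp hq
  rfl

theorem mul_gm_injective_iff (p q : ℕ) :
    (∀ ω : DF n p q, IsDF ω → mul (gm n) ω = 0 → ω = 0) ↔
      Function.Injective (metricMul n p q) := by
  rw [injective_iff_map_eq_zero]
  constructor
  · intro H F hF
    have h0 : mul (gm n) (fun x y => F x y) = 0 := by
      rw [← dfcast_eq_zero_iff (add_comm 1 p) (add_comm 1 q), dfcast_mul_gm fun _ _ => rfl, hF]
      rfl
    have h1 := H _ ⟨F, fun _ _ => rfl⟩ h0
    ext x y
    exact congrFun (congrFun h1 x) y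
  · rintro H ω ⟨F, hF⟩ h
    rw [← dfcast_eq_zero_iff (add_comm 1 p) (add_comm 1 q), dfcast_mul_gm (F := F) hF] at h
    have h0 : F = 0 := H F (by
      ext x y
      exact congrFun (congrFun h x) y)
    funext x y
    rw [hF, h0]
    rfl

theorem mul_gm_surjective_iff (p q : ℕ) :
    (∀ θ : DF n (p + 1) (q + 1), IsDF θ → ∃ ω : DF n p q, IsDF ω ∧
        emb (1 + p) (1 + q) (mul (gm n) ω) = emb (p + 1) (q + 1) θ) ↔
      Function.Surjective (metricMul n p q) := by
  simp only [emb_eq_emb_iff (add_comm 1 p) (add_comm 1 q)]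
  constructor
  · intro H G
    obtain ⟨ω, ⟨F, hF⟩, h⟩ := H (fun x y => G x y) ⟨G, fun _ _ => rfl⟩
    rw [dfcast_mul_gm (F := F) hF] at h
    refine ⟨F, ?_⟩
    ext x y
    exact congrFun (congrFun h x) y
  · rintro H θ ⟨G, hG⟩
    obtain ⟨F, hF⟩ := H G
    refine ⟨fun x y => F x y, ⟨F, fun _ _ => rfl⟩, ?_⟩
    rw [dfcast_mul_gm fun _ _ => rfl, hF]
    funext x y
    exact (hG x y).symm

end Auxiliary


/-- multiplication by `g` on `D^{p,q}` is injective iff `p + q ≤ n − 1`,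
bijective iff `p + q = n − 1`, and surjective iff `p + q ≥ n − 1`. -/
theorem g_mul_injective_bijective_surjective_iff (n p q : ℕ) (hp : p ≤ n) (hq : q ≤ n) :
    ((∀ ω : DF n p q, IsDF ω → mul (gm n) ω = 0 → ω = 0) ↔ p + q + 1 ≤ n) ∧
    (((∀ ω : DF n p q, IsDF ω → mul (gm n) ω = 0 → ω = 0) ∧
      (∀ θ : DF n (p + 1) (q + 1), IsDF θ → ∃ ω : DF n p q, IsDF ω ∧
        emb (1 + p) (1 + q) (mul (gm n) ω) = emb (p + 1) (q + 1) θ)) ↔ p + q + 1 = n) ∧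
    ((∀ θ : DF n (p + 1) (q + 1), IsDF θ → ∃ ω : DF n p q, IsDF ω ∧
        emb (1 + p) (1 + q) (mul (gm n) ω) = emb (p + 1) (q + 1) θ) ↔ n ≤ p + q + 1) := by
  rw [mul_gm_injective_iff, mul_gm_surjective_iff, metricMul_injective_iff hp hq,
    metricMul_surjective_iff hp hq]
  omega

end DoubleForm
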